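/- Let M be a finitely generated graded module over S = k[x_1,…,x_n] with minimal graded free resolution 0 → F_s → … → F_1 → F_0 → M, and let b_i be the maximum degree of the generators of F_i. Then for every t with 0 ≤ t ≤ n: (i) reg_t(M) = max{b_i − i : i ≥ n−t}; (ii) a*_t(M) = max{b_i : i ≥ n−t} − n. -/

import Mathlib

set_option synthInstance.maxHeartbeats 1000000
set_option maxHeartbeats 1000000

/-! Common definitions: gradings, term orders, initial ideals, generic initial ideals,
Borel-fixed ideals, filter-regular sequences, a Koszul/Čech-type description of graded
local cohomology and the invariants `a_i`, `reg_t`, `a*_t`, minimal graded free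
resolutions, and reductions. -/

namespace Paper

open MvPolynomial

noncomputable section

variable {k : Type*} [Field k] {n : ℕ}

/-- Total degree of an exponent vector. -/
def adeg (a : Fin n →₀ ℕ) : ℕ := ∑ j, a j

/-- `m(x^A)` : the largest (1-based) index `i` such that `xᵢ` divides `x^A`. -/
def mval (a : Fin n →₀ ℕ) : ℕ := a.support.sup fun j => (j : ℕ) + 1

/-- The degree-`d` homogeneous piece of the polynomial ring (`⊥` in negative degrees). -/
def sPiece (k : Type*) [Field k] (n : ℕ) (d : ℤ) : Submodule k (MvPolynomial (Fin n) k) :=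
  if 0 ≤ d then homogeneousSubmodule (Fin n) k d.toNat else ⊥

/-- `I` is a homogeneous (graded) ideal. -/
def IsHomog (I : Ideal (MvPolynomial (Fin n) k)) : Prop :=
  ∀ f ∈ I, ∀ d : ℕ, homogeneousComponent d f ∈ I

/-- Degree reverse lexicographic order with `x₁ > x₂ > ⋯ > xₙ` : `a < b`. -/
def drlt (a b : Fin n →₀ ℕ) : Prop :=
  adeg a < adeg b ∨
    (adeg a = adeg b ∧ ∃ i : Fin n, b i < a i ∧ ∀ j : Fin n, i < j → a j = b j)

/-- Lexicographic order with `x₁ > x₂ > ⋯ > xₙ` : `a < b`. -/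
def lexlt (a b : Fin n →₀ ℕ) : Prop :=
  ∃ i : Fin n, a i < b i ∧ ∀ j : Fin n, j < i → a j = b j

/-- An abstract term order on monomials in `n` variables. -/
structure TermOrder (n : ℕ) where
  lt : (Fin n →₀ ℕ) → (Fin n →₀ ℕ) → Prop
  irrefl : ∀ a, ¬ lt a a
  trans : ∀ a b c, lt a b → lt b c → lt a c
  total : ∀ a b, a ≠ b → lt a b ∨ lt b a
  add_right : ∀ a b c, lt a b → lt (a + c) (b + c)
  zero_bot : ∀ a, a ≠ 0 → lt 0 a

/-- `a` is the leading exponent of `f` with respect to the term order `lt`. -/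
def IsLeadExp (lt : (Fin n →₀ ℕ) → (Fin n →₀ ℕ) → Prop)
    (f : MvPolynomial (Fin n) k) (a : Fin n →₀ ℕ) : Prop :=
  a ∈ f.support ∧ ∀ b ∈ f.support, b ≠ a → lt b a

/-- The initial ideal of `I` with respect to the term order `lt`. -/
def inIdealW (lt : (Fin n →₀ ℕ) → (Fin n →₀ ℕ) → Prop)
    (I : Ideal (MvPolynomial (Fin n) k)) : Ideal (MvPolynomial (Fin n) k) :=
  Ideal.span {m | ∃ f a, f ∈ I ∧ IsLeadExp lt f a ∧ m = monomial a (1 : k)}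

/-- The initial ideal with respect to the (degree) reverse lexicographic order. -/
def inIdeal (I : Ideal (MvPolynomial (Fin n) k)) : Ideal (MvPolynomial (Fin n) k) :=
  inIdealW drlt I

/-- The linear change of coordinates associated to a matrix `g`, `xⱼ ↦ ∑ᵢ gᵢⱼ xᵢ`. -/
def act (g : Matrix (Fin n) (Fin n) k) :
    MvPolynomial (Fin n) k →ₐ[k] MvPolynomial (Fin n) k :=
  aeval fun j => ∑ i, C (g i j) * X i

/-- The image of the ideal `I` under the linear change of coordinates `g`. -/
def actI (g : Matrix (Fin n) (Fin n) k) (I : Ideal (MvPolynomial (Fin n) k)) :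
    Ideal (MvPolynomial (Fin n) k) :=
  Ideal.map (act g) I

/-- `J` is the generic initial ideal of `I` w.r.t. the term order `lt`:
there is a nonempty Zariski-open subset `U ⊆ GL(n,k)` with `in(g I) = J` for all `g ∈ U`. -/
def IsGinW (lt : (Fin n →₀ ℕ) → (Fin n →₀ ℕ) → Prop)
    (I J : Ideal (MvPolynomial (Fin n) k)) : Prop :=
  ∃ U : Set (Matrix (Fin n) (Fin n) k), U.Nonempty ∧
    (∃ P : Set (MvPolynomial (Fin n × Fin n) k),
      U = {g | IsUnit g.det ∧ ∃ p ∈ P, MvPolynomial.eval (fun q => g q.1 q.2) p ≠ 0}) ∧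
    ∀ g ∈ U, inIdealW lt (actI g I) = J

/-- Generic initial ideal with respect to the reverse lexicographic order. -/
def IsGin (I J : Ideal (MvPolynomial (Fin n) k)) : Prop := IsGinW drlt I J

/-- `I` is a monomial ideal. -/
def IsMonomialIdeal (I : Ideal (MvPolynomial (Fin n) k)) : Prop :=
  ∃ A : Set (Fin n →₀ ℕ), I = Ideal.span ((fun a => (monomial a (1 : k))) '' A)

/-- The maximal graded ideal `𝔐 = (x₁, …, xₙ)` of the polynomial ring. -/
def maxIdeal (k : Type*) [Field k] (n : ℕ) : Ideal (MvPolynomial (Fin n) k) :=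
  Ideal.span (Set.range X)

/-- `x^a` is a minimal (monomial) generator of the monomial ideal `I`. -/
def IsMinGen (I : Ideal (MvPolynomial (Fin n) k)) (a : Fin n →₀ ℕ) : Prop :=
  monomial a (1 : k) ∈ I ∧ monomial a (1 : k) ∉ maxIdeal k n * I

def IsUpperTriangular (g : Matrix (Fin n) (Fin n) k) : Prop :=
  ∀ i j : Fin n, j < i → g i j = 0

/-- `I` is Borel-fixed: fixed by every invertible upper triangular change of coordinates. -/
def IsBorelFixed (I : Ideal (MvPolynomial (Fin n) k)) : Prop :=
  ∀ g : Matrix (Fin n) (Fin n) k, IsUnit g.det → IsUpperTriangular g → actI g I = I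

/-- Degree-`d` piece of the standard grading on `S/I` (for `I` homogeneous). -/
def qPiece (I : Ideal (MvPolynomial (Fin n) k)) (d : ℤ) :
    Submodule k (MvPolynomial (Fin n) k ⧸ I) :=
  (sPiece k n d).map (Ideal.Quotient.mkₐ k I).toLinearMap

/-- Degree-`d` piece of the standard grading on the ideal `I` viewed as a module. -/
def iPiece (I : Ideal (MvPolynomial (Fin n) k)) (d : ℤ) : Submodule k ↥I :=
  (sPiece k n d).comap ((I.subtype).restrictScalars k)

/-- The maximal graded ideal of `S/I`. -/
def maxIdealQ (I : Ideal (MvPolynomial (Fin n) k)) : Ideal (MvPolynomial (Fin n) k ⧸ I) :=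
  (maxIdeal k n).map (Ideal.Quotient.mk I)

/-- `z 0, …, z (s-1)` is a filter-regular sequence in `R` (with maximal graded ideal `mR`):
`z i` avoids all associated primes `≠ mR` of `(z 0, …, z (i-1))`. -/
def FilterRegular {R : Type*} [CommRing R] (mR : Ideal R) (z : ℕ → R) (s : ℕ) : Prop :=
  ∀ i < s, ∀ p ∈ associatedPrimes R (R ⧸ Ideal.span {x | ∃ j < i, x = z j}),
    p ≠ mR → z i ∉ p

/-- The sequence `xₙ, xₙ₋₁, …, x₁` in `S/I` (extended by `0`). -/
def revVars (I : Ideal (MvPolynomial (Fin n) k)) (j : ℕ) :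
    MvPolynomial (Fin n) k ⧸ I :=
  if h : j < n then Ideal.Quotient.mk I (X ⟨n - 1 - j, by omega⟩) else 0

section LC

variable {M : Type*} [AddCommGroup M]

/-- `i`-cochains of the stable Koszul (Čech) complex on the variables. -/
abbrev Koch (n : ℕ) (M : Type*) (i : ℕ) : Type _ :=
  {T : Finset (Fin n) // T.card = i} → M

/-- The differential (into cohomological degree `i`) of the Koszul complex
on `x₁ᵗ, …, xₙᵗ` with coefficients in `M`. -/
def kdelta [Module (MvPolynomial (Fin n) k) M] (t i : ℕ)
    (v : Koch n M (i - 1)) : Koch n M i := fun T =>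
  ∑ j ∈ T.1.attach,
    ((-1 : ℤ) ^ ((T.1.filter (fun l => l < j.1)).card)) •
      ((X j.1 ^ t : MvPolynomial (Fin n) k) •
        v ⟨T.1.erase j.1, by rw [Finset.card_erase_of_mem j.2, T.2]⟩)

/-- The transition map from the Koszul complex at level `t` to the one at level `t+1`. -/
def ktrans [Module (MvPolynomial (Fin n) k) M] (i : ℕ) (v : Koch n M i) : Koch n M i :=
  fun T => ((∏ j ∈ T.1, X j : MvPolynomial (Fin n) k)) • v T

/-- The cochain `v` lies in the degree-`d` strand (for the grading `ℳ` of `M`,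
where the Koszul generators at level `t` have degree `t`). -/
def strand [Module k M] (ℳ : ℤ → Submodule k M) (t i : ℕ) (d : ℤ)
    (v : Koch n M i) : Prop :=
  ∀ T, v T ∈ ℳ (d + (t : ℤ) * (i : ℤ))

/-- `H^i_𝔐(M)_d ≠ 0` : the degree-`d` strand of `i`-th local cohomology (computed as the
direct limit over `t` of the Koszul cohomology on `x₁ᵗ, …, xₙᵗ`) is nonzero. -/
def lcNonvanish (n : ℕ) [Module k M] [Module (MvPolynomial (Fin n) k) M]
    (ℳ : ℤ → Submodule k M) (i : ℕ) (d : ℤ) : Prop :=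
  ∃ (t : ℕ) (v : Koch n M i),
    strand ℳ t i d v ∧ kdelta (k := k) t (i + 1) v = 0 ∧
    ∀ s : ℕ, ¬ ∃ w : Koch n M (i - 1),
      strand ℳ (t + s) (i - 1) d w ∧
        kdelta (k := k) (t + s) i w = (ktrans (k := k) i)^[s] v

open Classical in
/-- `a_i(M)` : the largest degree `d` with `H^i_𝔐(M)_d ≠ 0` (`⊥` if `H^i_𝔐(M) = 0`). -/
def aDeg (n : ℕ) [Module k M] [Module (MvPolynomial (Fin n) k) M]
    (ℳ : ℤ → Submodule k M) (i : ℕ) : WithBot ℤ :=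
  if (∃ d : ℤ, lcNonvanish n ℳ i d) then
    ((sSup {d : ℤ | lcNonvanish n ℳ i d} : ℤ) : WithBot ℤ)
  else ⊥

/-- `reg_t(M) = max{a_i(M) + i : i ≤ t}`. -/
def regT (n : ℕ) [Module k M] [Module (MvPolynomial (Fin n) k) M]
    (ℳ : ℤ → Submodule k M) (t : ℕ) : WithBot ℤ :=
  (Finset.range (t + 1)).sup fun i => aDeg n ℳ i + ((i : ℤ) : WithBot ℤ)

/-- `a*_t(M) = max{a_i(M) : i ≤ t}`. -/
def aStarT (n : ℕ) [Module k M] [Module (MvPolynomial (Fin n) k) M]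
    (ℳ : ℤ → Submodule k M) (t : ℕ) : WithBot ℤ :=
  (Finset.range (t + 1)).sup fun i => aDeg n ℳ i

end LC

open Classical in
/-- Supremum of a set of integers, as an element of `WithBot ℤ` (`⊥` for the empty set). -/
def zSupBot (A : Set ℤ) : WithBot ℤ :=
  if A.Nonempty then ((sSup A : ℤ) : WithBot ℤ) else ⊥

section Res

variable (k) (n)
variable (M : Type*) [AddCommGroup M] [Module k M]
  [Module (MvPolynomial (Fin n) k) M]

/-- A minimal graded free resolution `0 → F_len → ⋯ → F_1 → F_0 → M` of the graded
module `M` (with grading `ℳ`): `F i` is free with basis elements of degrees `tw i j`,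
the maps are degree-preserving, the complex is exact, and all differentials map into
`𝔐 ⬝ F i` (minimality). -/
structure MGFR (ℳ : ℤ → Submodule k M) where
  len : ℕ
  rk : ℕ → ℕ
  tw : (i : ℕ) → Fin (rk i) → ℤ
  rk_top : ∀ i, len < i → rk i = 0
  aug : (Fin (rk 0) → MvPolynomial (Fin n) k) →ₗ[MvPolynomial (Fin n) k] M
  diff : (i : ℕ) → ((Fin (rk (i + 1)) → MvPolynomial (Fin n) k)
      →ₗ[MvPolynomial (Fin n) k] (Fin (rk i) → MvPolynomial (Fin n) k))
  aug_surj : Function.Surjective aug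
  exact_zero : LinearMap.ker aug = LinearMap.range (diff 0)
  exact_succ : ∀ i, LinearMap.ker (diff i) = LinearMap.range (diff (i + 1))
  graded_aug : ∀ (d : ℤ) (v : Fin (rk 0) → MvPolynomial (Fin n) k),
    (∀ j, v j ∈ sPiece k n (d - tw 0 j)) → aug v ∈ ℳ d
  graded_diff : ∀ (i : ℕ) (d : ℤ) (v : Fin (rk (i + 1)) → MvPolynomial (Fin n) k),
    (∀ j, v j ∈ sPiece k n (d - tw (i + 1) j)) → ∀ j, diff i v j ∈ sPiece k n (d - tw i j)
  minimal : ∀ i, LinearMap.range (diff i) ≤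
    (maxIdeal k n) • (⊤ : Submodule (MvPolynomial (Fin n) k)
      (Fin (rk i) → MvPolynomial (Fin n) k))

variable {k n M} {ℳ : ℤ → Submodule k M}

/-- `b_i` : the maximum degree of the generators of `F_i` (`⊥` if `F_i = 0`). -/
def bdeg (res : MGFR k n M ℳ) (i : ℕ) : WithBot ℤ :=
  Finset.univ.sup fun j : Fin (res.rk i) => ((res.tw i j : ℤ) : WithBot ℤ)

/-- The `j`-th syzygy module of `M`, as a submodule of `F_j`. -/
def syzSub (res : MGFR k n M ℳ) : (j : ℕ) →
    Submodule (MvPolynomial (Fin n) k) (Fin (res.rk j) → MvPolynomial (Fin n) k)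
  | 0 => LinearMap.ker res.aug
  | (m + 1) => LinearMap.ker (res.diff m)

/-- The degree-`d` piece of the induced grading on the `j`-th syzygy module. -/
def syzPiece (res : MGFR k n M ℳ) (j : ℕ) (d : ℤ) :
    Submodule k ↥(syzSub res j) :=
  Submodule.comap ((syzSub res j).subtype.restrictScalars k)
    (Submodule.pi Set.univ fun l => sPiece k n (d - res.tw j l))

/-- The dual (transposed) differential, into cohomological degree `i`,
of the complex `Hom(F_•, S)` computing `Ext^•(M, S)`. -/
def extDiffInto (res : MGFR k n M ℳ) : (i : ℕ) →
    (Fin (res.rk (i - 1)) → MvPolynomial (Fin n) k) →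
      (Fin (res.rk i) → MvPolynomial (Fin n) k)
  | 0 => fun _ => 0
  | (m + 1) => fun u j' => ∑ j, res.diff m (Pi.single j' 1) j * u j

/-- `Ext^i_S(M, S)_r ≠ 0`, computed from the given minimal graded free resolution;
the dual basis element of a generator of degree `tw i j` has degree `-tw i j`. -/
def ExtNonzero (res : MGFR k n M ℳ) (i : ℕ) (r : ℤ) : Prop :=
  ∃ u : Fin (res.rk i) → MvPolynomial (Fin n) k,
    (∀ j, u j ∈ sPiece k n (r + res.tw i j)) ∧
    extDiffInto res (i + 1) u = 0 ∧
    ¬ ∃ w : Fin (res.rk (i - 1)) → MvPolynomial (Fin n) k, extDiffInto res i w = u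

end Res

section Red

variable {R : Type*} [CommRing R]

/-- `a` is a reduction of the ideal `mR` : `mR^(r+1) = a * mR^r` for all large `r`. -/
def IsReduction (mR a : Ideal R) : Prop :=
  a ≤ mR ∧ ∃ N, ∀ r ≥ N, mR ^ (r + 1) = a * mR ^ r

/-- `a` is a minimal reduction of `mR`. -/
def IsMinimalReduction (mR a : Ideal R) : Prop :=
  IsReduction mR a ∧ ∀ b, IsReduction mR b → b ≤ a → b = a

/-- The reduction number `r_a` : the least `r` with `mR^(r+1) = a * mR^r`. -/
def redNum (mR a : Ideal R) : ℕ := sInf {r | mR ^ (r + 1) = a * mR ^ r}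

/-- The reduction number: the minimum of `r_a` over all minimal reductions `a` of `mR`. -/
def ringRedNum (mR : Ideal R) : ℕ :=
  sInf {r | ∃ a, IsMinimalReduction mR a ∧ redNum mR a = r}

end Red


section Aux

/-- Total version of the Koszul differential, on all finsets at once. -/
def DD {M : Type*} [AddCommGroup M] [Module (MvPolynomial (Fin n) k) M] (t : ℕ)
    (V : Finset (Fin n) → M) (T : Finset (Fin n)) : M :=
  ∑ j ∈ T, ((-1 : ℤ) ^ ((T.filter (fun l => l < j)).card)) •
      ((X j ^ t : MvPolynomial (Fin n) k) • V (T.erase j))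

/-- Extension of a cochain by zero. -/
def extK {M : Type*} [AddCommGroup M] {i : ℕ} (v : Koch n M i) (T : Finset (Fin n)) : M :=
  if h : T.card = i then v ⟨T, h⟩ else 0

variable {M : Type*} [AddCommGroup M] [Module (MvPolynomial (Fin n) k) M]

lemma kdelta_of (t i : ℕ) (W : Finset (Fin n) → M) (T : {T : Finset (Fin n) // T.card = i}) :
    kdelta (k := k) t i (fun T => W T.1) T = DD (k := k) t W T.1 := by
  unfold kdelta DD
  exact Finset.sum_attach T.1 (fun j => ((-1 : ℤ) ^ ((T.1.filter (fun l => l < j)).card)) •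
      ((X j ^ t : MvPolynomial (Fin n) k) • W (T.1.erase j)))

lemma extK_coe {i : ℕ} (v : Koch n M i) : (fun T : {T : Finset (Fin n) // T.card = i} =>
    extK v T.1) = v := by
  funext T
  simp [extK, T.2]

lemma DD_extK (t i : ℕ) (v : Koch n M i) :
    DD (k := k) t (extK v) = extK (kdelta (k := k) t (i + 1) v) := by
  funext T
  by_cases h : T.card = i + 1
  · have h1 := kdelta_of (k := k) t (i + 1) (extK v) ⟨T, h⟩
    have h2 := extK_coe v
    rw [← h1]
    simp only [extK, h, dif_pos]
    congr 1
  · have : extK (kdelta (k := k) t (i + 1) v) T = 0 := by simp [extK, h]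
    rw [this]
    unfold DD
    apply Finset.sum_eq_zero
    intro j hj
    have hc : (T.erase j).card ≠ i := by
      have := Finset.card_erase_add_one hj
      omega
    simp [extK, hc]

/-- The sign. -/
def sg (T : Finset (Fin n)) (j : Fin n) : ℤ := (-1 : ℤ) ^ ((T.filter (fun l => l < j)).card)

lemma sg_sq (T : Finset (Fin n)) (j : Fin n) : sg T j * sg T j = 1 := by
  unfold sg
  rw [← pow_add, ← two_mul, pow_mul]
  simp

lemma sg_erase_lt (T : Finset (Fin n)) {j l : Fin n} (hj : j ∈ T) (h : j < l) :
    sg (T.erase j) l = - sg T l := by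
  unfold sg
  have : (T.filter (fun a => a < l)).card = ((T.erase j).filter (fun a => a < l)).card + 1 := by
    rw [Finset.filter_erase, Finset.card_erase_add_one]
    simp [hj, h]
  rw [this, pow_succ]
  ring

lemma sg_erase_gt (T : Finset (Fin n)) {j l : Fin n} (h : j < l) :
    sg (T.erase l) j = sg T j := by
  unfold sg
  congr 2
  ext a
  simp only [Finset.mem_filter, Finset.mem_erase]
  constructor
  · rintro ⟨⟨_, h1⟩, h2⟩; exact ⟨h1, h2⟩
  · rintro ⟨h1, h2⟩; exact ⟨⟨(h2.trans h).ne, h1⟩, h2⟩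

lemma sg_anti (T : Finset (Fin n)) {j l : Fin n} (hj : j ∈ T) (hl : l ∈ T) (h : j ≠ l) :
    sg T j * sg (T.erase j) l = - (sg T l * sg (T.erase l) j) := by
  rcases lt_or_gt_of_ne h with h | h
  · rw [sg_erase_lt T hj h, sg_erase_gt T h]; ring
  · rw [sg_erase_lt T hl h, sg_erase_gt T h]; ring

lemma DD_DD (t : ℕ) (V : Finset (Fin n) → M) : DD (k := k) t (DD (k := k) t V) = 0 := by
  funext T
  change ∑ j ∈ T, sg T j • ((X j ^ t : MvPolynomial (Fin n) k) •
    ∑ l ∈ T.erase j, sg (T.erase j) l • ((X l ^ t : MvPolynomial (Fin n) k) •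
      V ((T.erase j).erase l))) = 0
  simp only [Finset.smul_sum]
  rw [Finset.sum_sigma']
  refine Finset.sum_involution (fun p _ => ⟨p.2, p.1⟩) ?_ ?_ ?_ ?_
  · rintro ⟨j, l⟩ h
    simp only [Finset.mem_sigma, Finset.mem_erase] at h
    obtain ⟨hj, hlj, hl⟩ := h
    simp only
    rw [Finset.erase_right_comm (a := l) (b := j)]
    have e1 : ∀ (a b : ℤ) (f g : MvPolynomial (Fin n) k) (m : M),
        a • f • b • g • m = (a * b) • (f * g) • m := by
      intro a b f g m
      rw [smul_comm f b, mul_smul, mul_smul]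
    rw [e1, e1, sg_anti T hj hl (Ne.symm hlj), mul_comm (X j ^ t : MvPolynomial (Fin n) k), neg_smul]
    exact neg_add_cancel _
  · rintro ⟨j, l⟩ h _ h2
    simp only [Finset.mem_sigma, Finset.mem_erase] at h
    simp only [Sigma.mk.injEq, heq_eq_eq] at h2
    exact h.2.1 h2.1
  · rintro ⟨j, l⟩ h
    simp only [Finset.mem_sigma, Finset.mem_erase] at h ⊢
    exact ⟨h.2.2, Ne.symm h.2.1, h.1⟩
  · rintro ⟨j, l⟩ h
    rfl

lemma kdelta_zero' (t : ℕ) (v : Koch n M (0 - 1)) : kdelta (k := k) t 0 v = 0 := by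
  funext T
  have : T.1 = ∅ := Finset.card_eq_zero.mp T.2
  unfold kdelta
  apply Finset.sum_eq_zero
  intro j _
  have := j.2
  simp_all

lemma kdelta_kdelta (t i : ℕ) (v : Koch n M (i - 1)) :
    kdelta (k := k) t (i + 1) (kdelta (k := k) t i v) = 0 := by
  cases i with
  | zero =>
    rw [kdelta_zero']
    funext T
    simp [kdelta]
  | succ i =>
    have h1 := DD_extK (k := k) t (i + 1) (kdelta (k := k) t (i + 1) v)
    have h2 := DD_extK (k := k) (M := M) t i v
    rw [← h2, DD_DD] at h1
    funext T
    have h3 := congrFun (extK_coe (kdelta (k := k) t (i + 1 + 1) (kdelta (k := k) t (i + 1) v))) T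
    rw [← h3]
    exact (congrFun h1 T.1).symm

lemma kdelta_sub (t i : ℕ) (v w : Koch n M (i - 1)) :
    kdelta (k := k) t i (v - w) = kdelta (k := k) t i v - kdelta (k := k) t i w := by
  funext T
  simp only [kdelta, Pi.sub_apply, smul_sub, Finset.sum_sub_distrib]

lemma kdelta_map {N : Type*} [AddCommGroup N] [Module (MvPolynomial (Fin n) k) N]
    (g : M →ₗ[MvPolynomial (Fin n) k] N) (t i : ℕ) (v : Koch n M (i - 1)) :
    kdelta (k := k) t i (fun T => g (v T)) = fun T => g (kdelta (k := k) t i v T) := by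
  funext T
  simp only [kdelta, map_sum, map_smul, map_zsmul]

lemma ktrans_iter (i s : ℕ) (v : Koch n M i) :
    (ktrans (k := k) i)^[s] v = fun T => ((∏ j ∈ T.1, X j : MvPolynomial (Fin n) k) ^ s) • v T := by
  induction s with
  | zero => funext T; simp
  | succ s ih =>
    rw [Function.iterate_succ_apply', ih]
    funext T
    simp only [ktrans, smul_smul, pow_succ']

lemma kdelta_ktrans (t i : ℕ) (v : Koch n M i) :
    kdelta (k := k) (t + 1) (i + 1) (ktrans (k := k) i v) =
      ktrans (k := k) (i + 1) (kdelta (k := k) t (i + 1) v) := by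
  funext T
  simp only [kdelta, ktrans, Finset.smul_sum]
  refine Finset.sum_congr rfl fun j _ => ?_
  rw [smul_comm _ ((-1 : ℤ) ^ _), smul_smul, smul_smul, ← Finset.mul_prod_erase T.1 _ j.2]
  congr 2
  ring

lemma kdelta_ktrans_iter (t i s : ℕ) (v : Koch n M i) :
    kdelta (k := k) (t + s) (i + 1) ((ktrans (k := k) i)^[s] v) =
      (ktrans (k := k) (i + 1))^[s] (kdelta (k := k) t (i + 1) v) := by
  induction s with
  | zero => rfl
  | succ s ih =>
    rw [Function.iterate_succ_apply', Function.iterate_succ_apply', ← ih, ← kdelta_ktrans]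
    rfl

/-- Compatibility of a grading with multiplication by powers of variables. -/
def GrMul (n : ℕ) [Module (MvPolynomial (Fin n) k) M] [Module k M] (𝒜 : ℤ → Submodule k M) : Prop :=
  ∀ (j : Fin n) (t : ℕ) (e : ℤ) (a : M), a ∈ 𝒜 e →
    (X j ^ t : MvPolynomial (Fin n) k) • a ∈ 𝒜 (e + t)

lemma strand_kdelta [Module k M] {𝒜 : ℤ → Submodule k M} (h : GrMul n 𝒜) {t i : ℕ} {d : ℤ}
    {v : Koch n M i} (hv : strand 𝒜 t i d v) :
    strand 𝒜 t (i + 1) d (kdelta (k := k) t (i + 1) v) := by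
  intro T
  unfold kdelta
  refine Submodule.sum_mem _ fun j _ => ?_
  refine zsmul_mem ?_ _
  have := h j.1 t _ _ (hv ⟨T.1.erase j.1, by rw [Finset.card_erase_of_mem j.2, T.2]; rfl⟩)
  convert this using 2
  push_cast
  ring

lemma GrMul.prod [Module k M] {𝒜 : ℤ → Submodule k M} (h : GrMul n 𝒜) (T : Finset (Fin n))
    (e : ℤ) (a : M) (ha : a ∈ 𝒜 e) :
    (∏ j ∈ T, X j : MvPolynomial (Fin n) k) • a ∈ 𝒜 (e + T.card) := by
  induction T using Finset.induction_on with
  | empty => simpa using ha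
  | insert j T hj ih =>
    rw [Finset.prod_insert hj, mul_smul, Finset.card_insert_of_notMem hj]
    have := h j 1 _ _ ih
    rw [pow_one] at this
    convert this using 2
    push_cast
    ring

lemma strand_ktrans [Module k M] {𝒜 : ℤ → Submodule k M} (h : GrMul n 𝒜) {t i : ℕ} {d : ℤ}
    {v : Koch n M i} (hv : strand 𝒜 t i d v) (s : ℕ) :
    strand 𝒜 (t + s) i d ((ktrans (k := k) i)^[s] v) := by
  induction s with
  | zero => exact hv
  | succ s ih =>
    rw [Function.iterate_succ_apply']
    intro T
    have := h.prod T.1 _ _ (ih T)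
    change (∏ j ∈ T.1, X j : MvPolynomial (Fin n) k) • ((ktrans (k := k) i)^[s] v T) ∈ _
    convert this using 2
    rw [T.2]
    push_cast
    ring

end Aux

section SES

variable {A B C : Type*} [AddCommGroup A] [AddCommGroup B] [AddCommGroup C]
  [Module (MvPolynomial (Fin n) k) A] [Module (MvPolynomial (Fin n) k) B]
  [Module (MvPolynomial (Fin n) k) C] [Module k A] [Module k B] [Module k C]

/-- Short exact sequence of graded modules. -/
structure GSES (𝒜 : ℤ → Submodule k A) (ℬ : ℤ → Submodule k B) (𝒞 : ℤ → Submodule k C)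
    (f : A →ₗ[MvPolynomial (Fin n) k] B) (g : B →ₗ[MvPolynomial (Fin n) k] C) : Prop where
  inj : Function.Injective f
  ex : ∀ b, g b = 0 → ∃ a, f a = b
  gf : ∀ a, g (f a) = 0
  grA : ∀ e a, f a ∈ ℬ e ↔ a ∈ 𝒜 e
  grC : ∀ e b, b ∈ ℬ e → g b ∈ 𝒞 e
  lift : ∀ e c, c ∈ 𝒞 e → ∃ b ∈ ℬ e, g b = c
  mulB : GrMul n ℬ

/-- Strong vanishing in cohomological degree `i` and degree `d`. -/
def StrongVan (n : ℕ) [Module (MvPolynomial (Fin n) k) B] (ℬ : ℤ → Submodule k B)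
    (i : ℕ) (d : ℤ) : Prop :=
  ∀ (t : ℕ) (v : Koch n B i), strand ℬ t i d v → kdelta (k := k) t (i + 1) v = 0 →
    ∃ w : Koch n B (i - 1), strand ℬ t (i - 1) d w ∧ kdelta (k := k) t i w = v

variable {𝒜 : ℤ → Submodule k A} {ℬ : ℤ → Submodule k B} {𝒞 : ℤ → Submodule k C}
    {f : A →ₗ[MvPolynomial (Fin n) k] B} {g : B →ₗ[MvPolynomial (Fin n) k] C}

lemma ktrans_map (f : A →ₗ[MvPolynomial (Fin n) k] B) (i s : ℕ) (v : Koch n A i) :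
    (ktrans (k := k) i)^[s] (fun T => f (v T)) = fun T => f ((ktrans (k := k) i)^[s] v T) := by
  rw [ktrans_iter, ktrans_iter]
  funext T
  simp

lemma ktrans_iter_sub (i s : ℕ) (v w : Koch n A i) :
    (ktrans (k := k) i)^[s] (v - w) = (ktrans (k := k) i)^[s] v - (ktrans (k := k) i)^[s] w := by
  rw [ktrans_iter, ktrans_iter, ktrans_iter]
  funext T
  simp [smul_sub]

lemma GSES.up (H : GSES 𝒜 ℬ 𝒞 f g) {i : ℕ} {d : ℤ} (hB : StrongVan n ℬ i d)
    (h : lcNonvanish n 𝒞 i d) : lcNonvanish n 𝒜 (i + 1) d := by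
  obtain ⟨t, v, hv, hcv, hnv⟩ := h
  choose u hu hgu using fun T => H.lift _ _ (hv T)
  have hgu' : (fun T => g (u T)) = v := funext hgu
  have h1 : ∀ T, g (kdelta (k := k) t (i + 1) u T) = 0 := by
    intro T
    have := congrFun (kdelta_map (k := k) g t (i + 1) u) T
    rw [← this]
    exact (congrArg (fun q => kdelta (k := k) t (i + 1) q T) hgu').trans (congrFun hcv T)
  choose a ha using fun T => H.ex _ (h1 T)
  have ha' : (fun T => f (a T)) = kdelta (k := k) t (i + 1) u := funext ha
  refine ⟨t, a, ?_, ?_, ?_⟩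
  · intro T
    rw [← H.grA, ha]
    exact strand_kdelta H.mulB hu T
  · funext T
    apply H.inj
    have := congrFun (kdelta_map (k := k) f t (i + 1 + 1) a) T
    rw [← this]
    have h2 := congrFun (kdelta_kdelta (k := k) t (i + 1) u) T
    refine (congrArg (fun q => kdelta (k := k) t (i + 1 + 1) q T) ha').trans (h2.trans ?_)
    simp
  · rintro s ⟨w, hw, hdw⟩
    have hfw : kdelta (k := k) (t + s) (i + 1) ((ktrans (k := k) i)^[s] u - (fun T => f (w T) : Koch n B i)) = 0 := by
      have e1 := kdelta_sub (k := k) (t + s) (i + 1) ((ktrans (k := k) i)^[s] u) (fun T => f (w T))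
      have e2 := kdelta_map (k := k) f (t + s) (i + 1) w
      rw [hdw, ← ktrans_map, ha'] at e2
      have e3 := kdelta_ktrans_iter (k := k) t i s u
      rw [← e3] at e2
      exact e1.trans (sub_eq_zero.mpr e2.symm)
    obtain ⟨y, hy, hdy⟩ := hB (t + s) _ (fun T => Submodule.sub_mem _ (strand_ktrans H.mulB hu s T)
      ((H.grA _ _).2 (hw T))) hfw
    refine hnv s ⟨fun T => g (y T), fun T => H.grC _ _ (hy T), ?_⟩
    rw [kdelta_map, hdy, ← hgu', ktrans_map]
    funext T
    simp [H.gf]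

lemma GSES.down (H : GSES 𝒜 ℬ 𝒞 f g) {i : ℕ} {d : ℤ} {t : ℕ} {a : Koch n A (i + 1)}
    (hna : ∀ s : ℕ, ¬ ∃ w : Koch n A i, strand 𝒜 (t + s) i d w ∧
        kdelta (k := k) (t + s) (i + 1) w = (ktrans (k := k) (i + 1))^[s] a)
    {y : Koch n B i} (hy : strand ℬ t i d y)
    (hdy : kdelta (k := k) t (i + 1) y = fun T => f (a T)) : lcNonvanish n 𝒞 i d := by
  refine ⟨t, fun T => g (y T), fun T => H.grC _ _ (hy T), ?_, ?_⟩
  · have := kdelta_map (k := k) g t (i + 1) y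
    refine this.trans ?_
    rw [hdy]
    funext T
    simp [H.gf]
  · rintro s ⟨zb, hzb, hdz⟩
    choose z hz hgz using fun T => H.lift _ _ (hzb T)
    have hgz' : (fun T => g (z T)) = zb := funext hgz
    have h1 : ∀ T, g (((ktrans (k := k) i)^[s] y - kdelta (k := k) (t + s) i z) T) = 0 := by
      intro T
      have e1 := congrFun (ktrans_map (k := k) g i s y) T
      have e2 := congrFun (kdelta_map (k := k) g (t + s) i z) T
      rw [hgz', hdz] at e2
      rw [Pi.sub_apply, map_sub, ← e1, ← e2, sub_self]
    choose w hw using fun T => H.ex _ (h1 T)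
    have hw' : (fun T => f (w T)) = (ktrans (k := k) i)^[s] y - kdelta (k := k) (t + s) i z :=
      funext hw
    have hzs : strand ℬ (t + s) i d (kdelta (k := k) (t + s) i z) := by
      cases i with
      | zero =>
        rw [kdelta_zero']
        intro T
        exact Submodule.zero_mem _
      | succ i => exact strand_kdelta H.mulB hz
    refine hna s ⟨w, fun T => ?_, ?_⟩
    · rw [← H.grA, hw]
      exact Submodule.sub_mem _ (strand_ktrans H.mulB hy s T) (hzs T)
    · funext T
      apply H.inj
      have e1 := congrFun (kdelta_map (k := k) f (t + s) (i + 1) w) T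
      have e2 := kdelta_sub (k := k) (t + s) (i + 1) ((ktrans (k := k) i)^[s] y)
        (kdelta (k := k) (t + s) i z)
      have e3 := kdelta_kdelta (k := k) (t + s) i z
      have e4 := kdelta_ktrans_iter (k := k) t i s y
      have e5 := congrFun (ktrans_map (k := k) f (i + 1) s a) T
      rw [← e1, ← e5, ← hdy, ← e4]
      have e6 : kdelta (k := k) (t + s) (i + 1) (fun T => f (w T)) =
        kdelta (k := k) (t + s) (i + 1) ((ktrans (k := k) i)^[s] y) := by
        refine (congrArg _ hw').trans (e2.trans ?_)
        rw [e3, sub_zero]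
      exact congrFun e6 T

lemma GSES.down' (H : GSES 𝒜 ℬ 𝒞 f g) {i : ℕ} {d : ℤ} (hB : StrongVan n ℬ (i + 1) d)
    (h : lcNonvanish n 𝒜 (i + 1) d) : lcNonvanish n 𝒞 i d := by
  obtain ⟨t, a, ha, hca, hna⟩ := h
  obtain ⟨y, hy, hdy⟩ := hB t (fun T => f (a T)) (fun T => (H.grA _ _).2 (ha T)) (by
    refine (kdelta_map (k := k) f t (i + 1 + 1) a).trans ?_
    rw [hca]
    funext T
    simp)
  exact H.down hna hy hdy

lemma GSES.zero (H : GSES 𝒜 ℬ 𝒞 f g) {d : ℤ} (hB : StrongVan n ℬ 0 d) :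
    ¬ lcNonvanish n 𝒜 0 d := by
  rintro ⟨t, a, ha, hca, hna⟩
  obtain ⟨y, hy, hdy⟩ := hB t (fun T => f (a T)) (fun T => (H.grA _ _).2 (ha T)) (by
    refine (kdelta_map (k := k) f t (0 + 1) a).trans ?_
    rw [hca]
    funext T
    simp)
  rw [kdelta_zero'] at hdy
  refine hna 0 ⟨0, fun T => Submodule.zero_mem _, ?_⟩
  rw [kdelta_zero']
  funext T
  apply H.inj
  simpa using congrFun hdy T

lemma GSES.top (H : GSES 𝒜 ℬ 𝒞 f g) {d : ℤ} (hB : StrongVan n ℬ n d) :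
    ¬ lcNonvanish n 𝒞 n d := by
  rintro ⟨t, v, hv, hcv, hnv⟩
  choose u hu hgu using fun T => H.lift _ _ (hv T)
  have hgu' : (fun T => g (u T)) = v := funext hgu
  obtain ⟨y, hy, hdy⟩ := hB t u hu (by
    funext T
    have := Finset.card_le_univ T.1
    rw [T.2] at this
    simp at this)
  refine hnv 0 ⟨fun T => g (y T), fun T => H.grC _ _ (hy T), ?_⟩
  rw [← hgu']
  have := kdelta_map (k := k) g t n y
  rw [hdy] at this
  exact this

end SES

section Koszul

/-- The contracting homotopy in direction `l`. -/
def hh (t : ℕ) (l : Fin n) (V : Finset (Fin n) → MvPolynomial (Fin n) k) (T : Finset (Fin n)) :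
    MvPolynomial (Fin n) k :=
  if l ∈ T then 0 else sg (insert l T) l • ((V (insert l T)).divMonomial (Finsupp.single l t))

lemma coeff_X_pow_mul_ite (j : Fin n) (t : ℕ) (p : MvPolynomial (Fin n) k) (m : Fin n →₀ ℕ) :
    coeff m (X j ^ t * p) = if t ≤ m j then coeff (m - Finsupp.single j t) p else 0 := by
  rw [X_pow_eq_monomial, coeff_monomial_mul']
  simp

lemma div_X_mul {j l : Fin n} (h : j ≠ l) (t : ℕ) (p : MvPolynomial (Fin n) k) :
    (X j ^ t * p).divMonomial (Finsupp.single l t) =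
      X j ^ t * p.divMonomial (Finsupp.single l t) := by
  ext m
  rw [coeff_divMonomial, coeff_X_pow_mul_ite, coeff_X_pow_mul_ite, coeff_divMonomial]
  have : (Finsupp.single l t + m) j = m j := by simp [Finsupp.single_apply, h.symm]
  rw [this]
  split_ifs with hle
  · congr 1
    ext a
    by_cases ha : a = j
    · subst ha; simp [Finsupp.single_apply, h.symm]
    · simp [Finsupp.single_apply, Ne.symm ha]
  · rfl

/-- `divMonomial` as an additive map. -/
def divL (s : Fin n →₀ ℕ) : MvPolynomial (Fin n) k →+ MvPolynomial (Fin n) k :=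
  AddMonoidHom.mk' (fun p => p.divMonomial s) fun x y => add_divMonomial x y s

lemma hh_spec (t : ℕ) (l : Fin n) (V : Finset (Fin n) → MvPolynomial (Fin n) k)
    (hV : DD (k := k) t V = 0) (T : Finset (Fin n)) :
    V T - DD (k := k) t (hh t l V) T =
      if l ∈ T then V T - X l ^ t * (V T).divMonomial (Finsupp.single l t) else 0 := by
  by_cases hl : l ∈ T
  · rw [if_pos hl]
    congr 1
    change ∑ j ∈ T, sg T j • ((X j ^ t : MvPolynomial (Fin n) k) • hh t l V (T.erase j)) = _
    rw [Finset.sum_eq_single l]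
    · simp only [hh, Finset.mem_erase, ne_eq, not_true_eq_false, false_and, if_false,
        Finset.insert_erase hl]
      rw [smul_comm (X l ^ t : MvPolynomial (Fin n) k), smul_smul, sg_sq, one_smul, smul_eq_mul]
    · intro j hj hjl
      simp [hh, hl, Ne.symm hjl]
    · exact fun h => absurd hl h
  · rw [if_neg hl, sub_eq_zero]
    have h0 : ∑ j ∈ insert l T, sg (insert l T) j •
      ((X j ^ t : MvPolynomial (Fin n) k) • V ((insert l T).erase j)) = 0 := congrFun hV (insert l T)
    rw [Finset.sum_insert hl, Finset.erase_insert hl] at h0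
    have h1 := congrArg (fun p => sg (insert l T) l • divL (Finsupp.single l t) p) h0
    simp only [map_add, map_zero, smul_zero, map_sum, map_zsmul, smul_add, smul_smul, sg_sq,
      one_smul, Finset.smul_sum, smul_eq_mul] at h1
    have e1 : divL (Finsupp.single l t) (X l ^ t * V T) = V T := by
      change (X l ^ t * V T).divMonomial (Finsupp.single l t) = V T
      rw [X_pow_eq_monomial, divMonomial_monomial_mul]
    rw [e1] at h1
    rw [eq_neg_of_add_eq_zero_left h1, ← Finset.sum_neg_distrib]
    refine Finset.sum_congr rfl fun j hj => ?_
    have hjl : j ≠ l := fun h => hl (h ▸ hj)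
    have e2 : divL (Finsupp.single l t) (X j ^ t * V ((insert l T).erase j)) =
      X j ^ t * (V ((insert l T).erase j)).divMonomial (Finsupp.single l t) := div_X_mul hjl t _
    have e3 : insert l (T.erase j) = (insert l T).erase j :=
      (Finset.erase_insert_of_ne hjl.symm).symm
    have e4 : l ∉ T.erase j := fun h => hl (Finset.mem_of_mem_erase h)
    rw [e2]
    simp only [hh, e4, if_false, e3]
    rw [smul_comm (X j ^ t : MvPolynomial (Fin n) k), smul_smul, smul_eq_mul, ← neg_smul]
    congr 1
    have h2 := sg_anti (insert l T) (Finset.mem_insert_self l T) (Finset.mem_insert_of_mem hj)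
      hjl.symm
    rw [Finset.erase_insert hl] at h2
    change -_ = sg T j * _
    have h3 := sg_sq (insert l T) j
    have h4 := sg_sq ((insert l T).erase j) l
    calc -(sg (insert l T) l * sg (insert l T) j)
      = -(sg (insert l T) l * sg (insert l T) j) *
          (sg ((insert l T).erase j) l * sg ((insert l T).erase j) l) := by rw [h4, mul_one]
      _ = -(sg (insert l T) j * sg ((insert l T).erase j) l) * sg (insert l T) l *
          sg ((insert l T).erase j) l := by ring
      _ = (sg (insert l T) l * sg (insert l T) l) * sg T j * sg ((insert l T).erase j) l := by
          rw [← h2]; ring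
      _ = _ := by rw [sg_sq, one_mul]

lemma mem_sPiece {d : ℤ} {p : MvPolynomial (Fin n) k} :
    p ∈ sPiece k n d ↔ ∀ m, coeff m p ≠ 0 → (m.degree : ℤ) = d := by
  unfold sPiece
  split_ifs with h
  · rw [mem_homogeneousSubmodule]
    unfold IsHomogeneous IsWeightedHomogeneous
    refine forall_congr' fun m => forall_congr' fun _ => ?_
    have e : Finsupp.weight (1 : Fin n → ℕ) m = m.degree := by
      rw [Finsupp.degree_eq_weight_one]
      rfl
    rw [e]
    omega
  · rw [Submodule.mem_bot]
    constructor
    · rintro rfl m hm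
      simp at hm
    · intro H
      ext m
      by_contra hm
      have := H m hm
      omega

lemma hh_mem (t : ℕ) (l : Fin n) (V : Finset (Fin n) → MvPolynomial (Fin n) k) (d : ℤ)
    (hV : ∀ T, V T ∈ sPiece k n (d + t * T.card)) (T : Finset (Fin n)) :
    hh t l V T ∈ sPiece k n (d + t * T.card) := by
  unfold hh
  split_ifs with hl
  · exact Submodule.zero_mem _
  · refine zsmul_mem ?_ _
    rw [mem_sPiece]
    intro m hm
    rw [coeff_divMonomial] at hm
    have := mem_sPiece.1 (hV _) _ hm
    rw [Finset.card_insert_of_notMem hl] at this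
    simp only [map_add, Finsupp.degree_single] at this
    push_cast at this
    linarith

lemma DD_mem (t : ℕ) (V : Finset (Fin n) → MvPolynomial (Fin n) k) (d : ℤ)
    (hV : ∀ T, V T ∈ sPiece k n (d + t * T.card)) (T : Finset (Fin n)) :
    DD (k := k) t V T ∈ sPiece k n (d + t * T.card) := by
  unfold DD
  refine Submodule.sum_mem _ fun j hj => zsmul_mem ?_ _
  rw [mem_sPiece, smul_eq_mul]
  intro m hm
  rw [coeff_X_pow_mul_ite] at hm
  split_ifs at hm with h
  · have h1 := mem_sPiece.1 (hV _) _ hm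
    have h2 : (m - Finsupp.single j t) + Finsupp.single j t = m :=
      tsub_add_cancel_of_le (by simpa using h)
    have h3 := congrArg Finsupp.degree h2
    simp only [map_add, Finsupp.degree_single] at h3
    have h4 := Finset.card_erase_add_one hj
    rw [← h3, ← h4]
    push_cast
    rw [h1]
    ring
  · exact absurd rfl hm

lemma DD_sub {M : Type*} [AddCommGroup M] [Module (MvPolynomial (Fin n) k) M] (t : ℕ)
    (V W : Finset (Fin n) → M) : DD (k := k) t (V - W) = DD (k := k) t V - DD (k := k) t W := by
  funext T
  simp only [DD, Pi.sub_apply, smul_sub, Finset.sum_sub_distrib]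

lemma DD_add {M : Type*} [AddCommGroup M] [Module (MvPolynomial (Fin n) k) M] (t : ℕ)
    (V W : Finset (Fin n) → M) : DD (k := k) t (V + W) = DD (k := k) t V + DD (k := k) t W := by
  funext T
  simp only [DD, Pi.add_apply, smul_add, Finset.sum_add_distrib]

lemma koszul_reduce (t : ℕ) (V : Finset (Fin n) → MvPolynomial (Fin n) k) (d : ℤ)
    (hV : ∀ T, V T ∈ sPiece k n (d + t * T.card)) (hD : DD (k := k) t V = 0)
    (L : Finset (Fin n)) : ∃ W : Finset (Fin n) → MvPolynomial (Fin n) k,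
      (∀ T, W T ∈ sPiece k n (d + t * T.card)) ∧
      ∀ T m, coeff m (V T - DD (k := k) t W T) ≠ 0 →
        L ⊆ T ∧ (∀ l ∈ L, m l < t) ∧ coeff m (V T) ≠ 0 := by
  induction L using Finset.induction_on with
  | empty =>
    refine ⟨0, fun T => Submodule.zero_mem _, fun T m h => ?_⟩
    have : DD (k := k) t (0 : Finset (Fin n) → MvPolynomial (Fin n) k) T = 0 := by simp [DD]
    rw [this, sub_zero] at h
    simpa using h
  | insert l L hl ih =>
    obtain ⟨W, hW, hWc⟩ := ih
    have hD' : DD (k := k) t (V - DD (k := k) t W) = 0 := by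
      rw [DD_sub, hD, DD_DD, sub_zero]
    have hV' : ∀ T, (V - DD (k := k) t W) T ∈ sPiece k n (d + t * T.card) := fun T =>
      Submodule.sub_mem _ (hV T) (DD_mem t W d hW T)
    refine ⟨W + hh t l (V - DD (k := k) t W), fun T =>
      Submodule.add_mem _ (hW T) (hh_mem t l _ d hV' T), fun T m h => ?_⟩
    have e := hh_spec t l _ hD' T
    rw [DD_add, Pi.add_apply, ← sub_sub] at h
    rw [Pi.sub_apply] at e
    rw [e] at h
    split_ifs at h with hlT
    · rw [coeff_sub, coeff_X_pow_mul_ite, coeff_divMonomial] at h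
      split_ifs at h with hle
      · rw [add_tsub_cancel_of_le (by simpa using hle), sub_self] at h
        exact absurd rfl h
      · rw [sub_zero] at h
        obtain ⟨h1, h2, h3⟩ := hWc T m h
        refine ⟨Finset.insert_subset hlT h1, ?_, h3⟩
        intro a ha
        rcases Finset.mem_insert.1 ha with rfl | ha
        · omega
        · exact h2 a ha
    · simp at h

lemma koszul_exact (t : ℕ) (V : Finset (Fin n) → MvPolynomial (Fin n) k) (d : ℤ)
    (hV : ∀ T, V T ∈ sPiece k n (d + t * T.card)) (hD : DD (k := k) t V = 0)
    (htop : ∀ m, (∀ l, m l < t) → coeff m (V Finset.univ) = 0) :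
    ∃ W : Finset (Fin n) → MvPolynomial (Fin n) k,
      (∀ T, W T ∈ sPiece k n (d + t * T.card)) ∧ V = DD (k := k) t W := by
  obtain ⟨W, hW, hc⟩ := koszul_reduce t V d hV hD Finset.univ
  refine ⟨W, hW, ?_⟩
  funext T
  rw [← sub_eq_zero]
  ext m
  by_contra h
  obtain ⟨h1, h2, h3⟩ := hc T m h
  obtain rfl := Finset.univ_subset_iff.1 h1
  exact h3 (htop m fun l => h2 l (Finset.mem_univ l))

/-- Grading on the free module with twists `tw`. -/
def fPiece (k : Type*) [Field k] (n : ℕ) {r : ℕ} (tw : Fin r → ℤ) (d : ℤ) :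
    Submodule k (Fin r → MvPolynomial (Fin n) k) :=
  Submodule.pi Set.univ fun l => sPiece k n (d - tw l)

lemma mem_fPiece {r : ℕ} {tw : Fin r → ℤ} {d : ℤ} {v : Fin r → MvPolynomial (Fin n) k} :
    v ∈ fPiece k n tw d ↔ ∀ l, v l ∈ sPiece k n (d - tw l) := by
  simp [fPiece, Submodule.mem_pi]

lemma grMul_fPiece {r : ℕ} (tw : Fin r → ℤ) : GrMul n (fPiece k n tw) := by
  intro j t e a ha
  rw [mem_fPiece] at ha ⊢
  intro l
  rw [mem_sPiece, Pi.smul_apply, smul_eq_mul]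
  intro m hm
  rw [coeff_X_pow_mul_ite] at hm
  split_ifs at hm with h
  · have h1 := mem_sPiece.1 (ha l) _ hm
    have h2 : (m - Finsupp.single j t) + Finsupp.single j t = m :=
      tsub_add_cancel_of_le (by simpa using h)
    have h3 := congrArg Finsupp.degree h2
    simp only [map_add, Finsupp.degree_single] at h3
    rw [← h3]
    push_cast
    rw [h1]
    ring
  · exact absurd rfl hm

lemma free_exact {r : ℕ} (tw : Fin r → ℤ) (i t : ℕ) (d : ℤ)
    (v : Koch n (Fin r → MvPolynomial (Fin n) k) i) (hv : strand (fPiece k n tw) t i d v)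
    (hD : kdelta (k := k) t (i + 1) v = 0)
    (htop : ∀ T p m, (∀ l, m l < t) → T.1 = Finset.univ → coeff m (v T p) = 0) :
    ∃ w : Koch n (Fin r → MvPolynomial (Fin n) k) (i - 1),
      strand (fPiece k n tw) t (i - 1) d w ∧ kdelta (k := k) t i w = v := by
  have key : ∀ p, ∃ W : Finset (Fin n) → MvPolynomial (Fin n) k,
      (∀ T, W T ∈ sPiece k n (d - tw p + t * T.card)) ∧
        (fun T => extK v T p) = DD (k := k) t W := by
    intro p
    apply koszul_exact
    · intro T
      by_cases h : T.card = i
      · simp only [extK, h, dif_pos]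
        have := mem_fPiece.1 (hv ⟨T, h⟩) p
        convert this using 2
        ring
      · simp only [extK, h, dif_neg, not_false_eq_true]
        exact Submodule.zero_mem _
    · have h1 := DD_extK (k := k) t i v
      rw [hD] at h1
      funext T
      have h2 := congrFun (congrFun h1 T) p
      have h3 : extK (0 : Koch n (Fin r → MvPolynomial (Fin n) k) (i + 1)) T p = 0 := by
        unfold extK
        split_ifs <;> rfl
      rw [h3] at h2
      rw [Pi.zero_apply, ← h2]
      simp only [DD, Finset.sum_apply, Pi.smul_apply]
    · intro m hm
      unfold extK
      split_ifs with h
      · exact htop _ p m hm rfl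
      · simp
  choose W hW hWD using key
  refine ⟨fun T p => W p T.1, fun T => ?_, ?_⟩
  · rw [mem_fPiece]
    intro p
    have := hW p T.1
    rw [T.2] at this
    convert this using 2
    ring
  · funext T
    have e := kdelta_of (k := k) t i (fun T p => W p T) T
    refine e.trans ?_
    funext p
    have := congrFun (hWD p) T.1
    rw [congrFun (extK_coe v) T] at this
    rw [this]
    simp only [DD, Finset.sum_apply, Pi.smul_apply]

lemma strongVan_lt {r : ℕ} (tw : Fin r → ℤ) (i : ℕ) (d : ℤ) (hi : i < n) :
    StrongVan n (fPiece k n tw) i d := by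
  intro t v hv hD
  refine free_exact tw i t d v hv hD fun T p m _ hT => ?_
  have := T.2
  rw [hT, Finset.card_univ, Fintype.card_fin] at this
  omega

lemma strongVan_top {r : ℕ} (tw : Fin r → ℤ) (d : ℤ) (h : ∀ p, tw p < d + n) :
    StrongVan n (fPiece k n tw) n d := by
  intro t v hv hD
  refine free_exact tw n t d v hv hD fun T p m hm hT => ?_
  by_contra hc
  have h1 := mem_sPiece.1 (mem_fPiece.1 (hv T) p) m hc
  have h2 : m.degree + n ≤ t * n := by
    have : ∑ l : Fin n, (m l + 1) ≤ ∑ l : Fin n, t := Finset.sum_le_sum fun l _ => hm l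
    rw [Finset.sum_add_distrib] at this
    simp only [Finset.sum_const, Finset.card_univ, Fintype.card_fin, smul_eq_mul, mul_one] at this
    rw [Finsupp.degree_eq_sum]
    linarith
  have h3 := h p
  zify at h2
  linarith

end Koszul

section Resol

/-- Homogeneous component with integer degree. -/
def compZ (d : ℤ) (p : MvPolynomial (Fin n) k) : MvPolynomial (Fin n) k :=
  if 0 ≤ d then homogeneousComponent d.toNat p else 0

lemma coeff_compZ (d : ℤ) (p : MvPolynomial (Fin n) k) (m : Fin n →₀ ℕ) :
    coeff m (compZ d p) = if (m.degree : ℤ) = d then coeff m p else 0 := by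
  unfold compZ
  split_ifs with h h2 h2
  · rw [coeff_homogeneousComponent, if_pos (by omega)]
  · rw [coeff_homogeneousComponent, if_neg (by omega)]
  · omega
  · simp

/-- Projection of the free module onto its degree `d` part. -/
def projF {r : ℕ} (tw : Fin r → ℤ) (d : ℤ) :
    (Fin r → MvPolynomial (Fin n) k) →+ (Fin r → MvPolynomial (Fin n) k) :=
  AddMonoidHom.mk' (fun v l => compZ (d - tw l) (v l)) (by
    intro a b
    funext l
    ext m
    simp only [Pi.add_apply, coeff_add, coeff_compZ]
    split_ifs <;> simp)

lemma coeff_projF {r : ℕ} (tw : Fin r → ℤ) (d : ℤ) (v : Fin r → MvPolynomial (Fin n) k)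
    (l : Fin r) (m : Fin n →₀ ℕ) : coeff m (projF tw d v l) =
      if (m.degree : ℤ) = d - tw l then coeff m (v l) else 0 := coeff_compZ _ _ _

lemma projF_mem {r : ℕ} (tw : Fin r → ℤ) (d : ℤ) (v : Fin r → MvPolynomial (Fin n) k) :
    projF tw d v ∈ fPiece k n tw d := by
  rw [mem_fPiece]
  intro l
  rw [mem_sPiece]
  intro m hm
  rw [coeff_projF] at hm
  by_contra h
  simp [h] at hm

lemma projF_same {r : ℕ} (tw : Fin r → ℤ) (d : ℤ) (v : Fin r → MvPolynomial (Fin n) k)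
    (hv : v ∈ fPiece k n tw d) : projF tw d v = v := by
  funext l
  ext m
  rw [coeff_projF]
  split_ifs with h
  · rfl
  · by_contra h2
    exact h (mem_sPiece.1 (mem_fPiece.1 hv l) m (Ne.symm h2))

lemma projF_ne {r : ℕ} (tw : Fin r → ℤ) (d e : ℤ) (hde : e ≠ d)
    (v : Fin r → MvPolynomial (Fin n) k)
    (hv : v ∈ fPiece k n tw e) : projF tw d v = 0 := by
  funext l
  ext m
  rw [coeff_projF]
  split_ifs with h
  · by_contra h2
    have := mem_sPiece.1 (mem_fPiece.1 hv l) m h2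
    omega
  · simp

lemma projF_sum {r : ℕ} (tw : Fin r → ℤ) (v : Fin r → MvPolynomial (Fin n) k) :
    ∃ s : Finset ℤ, v = ∑ e ∈ s, projF tw e v := by
  classical
  refine ⟨Finset.univ.biUnion fun l => (v l).support.image fun m => (m.degree : ℤ) + tw l, ?_⟩
  funext l
  ext m
  rw [Finset.sum_apply, coeff_sum]
  simp only [coeff_projF]
  have : ∀ e : ℤ, ((m.degree : ℤ) = e - tw l) ↔ ((m.degree : ℤ) + tw l = e) := fun e => by
    constructor <;> intro h <;> omega
  simp only [this]
  rw [Finset.sum_ite_eq]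
  split_ifs with h
  · rfl
  · by_contra h2
    apply h
    simp only [Finset.mem_biUnion, Finset.mem_univ, true_and, Finset.mem_image, mem_support_iff]
    exact ⟨l, m, h2, rfl⟩

lemma lift_hom {r : ℕ} (tw : Fin r → ℤ) {C : Type*} [AddCommGroup C] [Module k C]
    [Module (MvPolynomial (Fin n) k) C] (𝒞 : ℤ → Submodule k C)
    (g : (Fin r → MvPolynomial (Fin n) k) →ₗ[MvPolynomial (Fin n) k] C)
    (hg : ∀ e b, b ∈ fPiece k n tw e → g b ∈ 𝒞 e) (Q : ℤ → C →+ C)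
    (hQ : ∀ d c, c ∈ 𝒞 d → Q d c = c) (hQ0 : ∀ d e c, e ≠ d → c ∈ 𝒞 e → Q d c = 0)
    (d : ℤ) (c : C) (hc : c ∈ 𝒞 d) (hb : ∃ b, g b = c) : ∃ b ∈ fPiece k n tw d, g b = c := by
  obtain ⟨b, rfl⟩ := hb
  obtain ⟨s, hs⟩ := projF_sum tw b
  have h1 : g b = ∑ e ∈ s, Q d (g (projF tw e b)) := by
    rw [← map_sum, ← map_sum, ← hs, hQ d _ hc]
  by_cases hd : d ∈ s
  · refine ⟨projF tw d b, projF_mem _ _ _, ?_⟩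
    rw [Finset.sum_eq_single d] at h1
    · rw [h1, hQ d _ (hg _ _ (projF_mem _ _ _))]
    · intro e _ he
      exact hQ0 d e _ he (hg _ _ (projF_mem _ _ _))
    · exact fun h => absurd hd h
  · refine ⟨0, Submodule.zero_mem _, ?_⟩
    rw [h1, map_zero]
    refine (Finset.sum_eq_zero fun e he => ?_).symm
    exact hQ0 d e _ (fun h => hd (h ▸ he)) (hg _ _ (projF_mem _ _ _))

variable {M : Type*} [AddCommGroup M] [Module k M] [Module (MvPolynomial (Fin n) k) M]
  {ℳ : ℤ → Submodule k M}

lemma syzSub_eq_range (res : MGFR k n M ℳ) (m : ℕ) :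
    syzSub res m = LinearMap.range (res.diff m) := by
  cases m with
  | zero => exact res.exact_zero
  | succ m => exact res.exact_succ m

/-- The surjection of `F_{m+1}` onto the syzygy module. -/
def dm (res : MGFR k n M ℳ) (m : ℕ) : (Fin (res.rk (m + 1)) → MvPolynomial (Fin n) k)
    →ₗ[MvPolynomial (Fin n) k] ↥(syzSub res m) :=
  (res.diff m).codRestrict (syzSub res m) fun x => by
    rw [syzSub_eq_range]
    exact ⟨x, rfl⟩

lemma gses_zero (hdec : DirectSum.IsInternal ℳ) (res : MGFR k n M ℳ) :
    GSES (syzPiece res 0) (fPiece k n (res.tw 0)) ℳ (syzSub res 0).subtype res.aug where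
  inj := Subtype.val_injective
  ex b hb := ⟨⟨b, hb⟩, rfl⟩
  gf a := a.2
  grA e a := Iff.rfl
  grC e b hb := res.graded_aug e b (mem_fPiece.1 hb)
  lift e c hc := by
    let _ := hdec.chooseDecomposition
    refine lift_hom (res.tw 0) ℳ res.aug (fun e b hb => res.graded_aug e b (mem_fPiece.1 hb))
      (fun d => AddMonoidHom.mk' (fun c => (DirectSum.decompose ℳ c d : M)) ?_) ?_ ?_ e c hc
      (res.aug_surj c)
    · intro a b
      simp
    · intro d c hc
      exact DirectSum.decompose_of_mem_same ℳ hc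
    · intro d e c hde hc
      exact DirectSum.decompose_of_mem_ne ℳ hc hde
  mulB := grMul_fPiece _

lemma gses_succ (res : MGFR k n M ℳ) (m : ℕ) :
    GSES (syzPiece res (m + 1)) (fPiece k n (res.tw (m + 1))) (syzPiece res m)
      (syzSub res (m + 1)).subtype (dm res m) where
  inj := Subtype.val_injective
  ex b hb := ⟨⟨b, congrArg Subtype.val hb⟩, rfl⟩
  gf a := Subtype.ext a.2
  grA e a := Iff.rfl
  grC e b hb := mem_fPiece.2 (res.graded_diff m e b (mem_fPiece.1 hb))
  lift e c hc := by
    have h1 : ∃ b, res.diff m b = c.1 := by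
      exact (syzSub_eq_range res m).le c.2
    obtain ⟨b, hb, hbc⟩ := lift_hom (res.tw (m + 1)) (fPiece k n (res.tw m)) (res.diff m)
      (fun e b hb => mem_fPiece.2 (res.graded_diff m e b (mem_fPiece.1 hb)))
      (fun d => projF (res.tw m) d) (fun d c hc => projF_same _ d c hc)
      (fun d e c hde hc => projF_ne _ d e hde c hc) e c.1 hc h1
    exact ⟨b, hb, Subtype.ext hbc⟩
  mulB := grMul_fPiece _

/-- Nonvanishing of local cohomology for `M` (index `0`) and its syzygies. -/
def NVZ (res : MGFR k n M ℳ) (d : ℤ) (i : ℕ) : ℕ → Prop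
  | 0 => lcNonvanish n ℳ i d
  | m + 1 => lcNonvanish n (syzPiece res m) i d

lemma NVZ_up (hdec : DirectSum.IsInternal ℳ) (res : MGFR k n M ℳ) {d : ℤ} {i m : ℕ} (hi : i < n)
    (h : NVZ res d i m) : NVZ res d (i + 1) (m + 1) := by
  cases m with
  | zero => exact (gses_zero hdec res).up (strongVan_lt _ i d hi) h
  | succ m => exact (gses_succ res m).up (strongVan_lt _ i d hi) h

lemma NVZ_down (hdec : DirectSum.IsInternal ℳ) (res : MGFR k n M ℳ) {d : ℤ} {i m : ℕ}
    (hi : i + 1 < n) (h : NVZ res d (i + 1) (m + 1)) : NVZ res d i m := by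
  cases m with
  | zero => exact (gses_zero hdec res).down' (strongVan_lt _ (i + 1) d hi) h
  | succ m => exact (gses_succ res m).down' (strongVan_lt _ (i + 1) d hi) h

lemma NVZ_zero (hdec : DirectSum.IsInternal ℳ) (res : MGFR k n M ℳ) {d : ℤ} {m : ℕ}
    (hn : 0 < n) : ¬ NVZ res d 0 (m + 1) := by
  cases m with
  | zero => exact (gses_zero hdec res).zero (strongVan_lt _ 0 d hn)
  | succ m => exact (gses_succ res m).zero (strongVan_lt _ 0 d hn)

lemma NVZ_top (hdec : DirectSum.IsInternal ℳ) (res : MGFR k n M ℳ) {d : ℤ} {m : ℕ}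
    (h : NVZ res d n m) : ∃ p, d + n ≤ res.tw m p := by
  by_contra! hc
  cases m with
  | zero => exact (gses_zero hdec res).top (strongVan_top _ d hc) h
  | succ m => exact (gses_succ res m).top (strongVan_top _ d hc) h

lemma upper (hdec : DirectSum.IsInternal ℳ) (res : MGFR k n M ℳ) {d : ℤ} {i : ℕ}
    (h : lcNonvanish n ℳ i d) : i ≤ n ∧ ∃ p, d + n ≤ res.tw (n - i) p := by
  have hi : i ≤ n := by
    by_contra hi
    obtain ⟨t, v, hv, hcv, hnv⟩ := h
    refine hnv 0 ⟨0, fun T => Submodule.zero_mem _, ?_⟩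
    funext T
    have := Finset.card_le_univ T.1
    rw [T.2, Fintype.card_fin] at this
    omega
  refine ⟨hi, ?_⟩
  have key : ∀ m, i + m ≤ n → NVZ res d (i + m) m := by
    intro m
    induction m with
    | zero => intro _; exact h
    | succ m ih => intro hm; exact NVZ_up hdec res (show i + m < n by omega) (ih (by omega))
  have := key (n - i) (by omega)
  rw [Nat.add_sub_cancel' hi] at this
  exact NVZ_top hdec res this

lemma chain_down (hdec : DirectSum.IsInternal ℳ) (res : MGFR k n M ℳ) {d : ℤ} (m : ℕ) :
    ∀ i, i < n → NVZ res d i m → m ≤ i ∧ lcNonvanish n ℳ (i - m) d := by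
  induction m with
  | zero => intro i _ h; exact ⟨Nat.zero_le _, h⟩
  | succ m ih =>
    intro i hi h
    cases i with
    | zero => exact absurd h (NVZ_zero hdec res hi)
    | succ i =>
      obtain ⟨h1, h2⟩ := ih i (by omega) (NVZ_down hdec res hi h)
      refine ⟨by omega, ?_⟩
      rwa [Nat.add_sub_add_right]

lemma top_nonvan {r : ℕ} {C : Type*} [AddCommGroup C] [Module (MvPolynomial (Fin n) k) C]
    (g : (Fin r → MvPolynomial (Fin n) k) →ₗ[MvPolynomial (Fin n) k] C)
    (hs : Function.Surjective g) (p : Fin r) (hker : ∀ x, g x = 0 → x p = 0) (s : ℕ)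
    (w : Koch n C (n - 1))
    (hw : kdelta (k := k) (1 + s) n w = (ktrans (k := k) n)^[s] fun _ => g (Pi.single p 1)) :
    False := by
  choose W hW using fun T => hs (w T)
  have hW' : (fun T => g (W T)) = w := funext hW
  let T : {T : Finset (Fin n) // T.card = n} := ⟨Finset.univ, by simp⟩
  have e1 := congrFun (kdelta_map (k := k) g (1 + s) n W) T
  rw [hW', hw, ktrans_iter] at e1
  simp only at e1
  rw [← map_smul, ← sub_eq_zero, ← map_sub] at e1
  have e2 := hker _ e1
  let m : Fin n →₀ ℕ := Finsupp.equivFunOnFinite.symm fun _ => s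
  have e3 := congrArg (coeff m) e2
  have e4 : ((∏ j ∈ T.1, X j : MvPolynomial (Fin n) k) ^ s) = monomial m 1 := by
    rw [monomial_eq, Finsupp.prod_fintype _ _ (by simp), ← Finset.prod_pow]
    simp [T, m]
  rw [Pi.sub_apply, coeff_sub, Pi.smul_apply, Pi.single_eq_same, smul_eq_mul, mul_one, e4,
    coeff_monomial, if_pos rfl, coeff_zero] at e3
  have e5 : coeff m (kdelta (k := k) (1 + s) n W T p) = 0 := by
    simp only [kdelta, Finset.sum_apply, coeff_sum]
    refine Finset.sum_eq_zero fun j _ => ?_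
    rw [Pi.smul_apply, coeff_smul, Pi.smul_apply, smul_eq_mul, coeff_X_pow_mul_ite, if_neg, smul_zero]
    simp [m]
  rw [e5, sub_zero] at e3
  exact one_ne_zero e3

lemma maxIdeal_coeff {p : MvPolynomial (Fin n) k} (hp : p ∈ maxIdeal k n) : coeff 0 p = 0 := by
  have : maxIdeal k n ≤ RingHom.ker (constantCoeff (σ := Fin n) (R := k)) := by
    unfold maxIdeal
    rw [Ideal.span_le]
    rintro _ ⟨j, rfl⟩
    simp
  exact this hp

lemma minimal_coeff (res : MGFR k n M ℳ) (i : ℕ) (x : Fin (res.rk (i + 1)) → MvPolynomial (Fin n) k)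
    (q : Fin (res.rk i)) : coeff 0 (res.diff i x q) = 0 := by
  have h := res.minimal i ⟨x, rfl⟩
  refine Submodule.smul_induction_on (p := fun y => coeff 0 (y q) = 0) h ?_ ?_
  · intro r hr y _
    have : r * y q ∈ maxIdeal k n := Ideal.mul_mem_right _ _ hr
    exact maxIdeal_coeff this
  · intro a b ha hb
    rw [Pi.add_apply, coeff_add, ha, hb, add_zero]

lemma single_mem {r : ℕ} (tw : Fin r → ℤ) (p : Fin r) :
    (Pi.single p 1 : Fin r → MvPolynomial (Fin n) k) ∈ fPiece k n tw (tw p) := by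
  rw [mem_fPiece]
  intro l
  rw [mem_sPiece]
  intro m hm
  by_cases h : l = p
  · subst h
    rw [Pi.single_eq_same, coeff_one] at hm
    by_cases h0 : 0 = m
    · subst h0; simp
    · simp [h0] at hm
  · simp [h] at hm

lemma diff_coord_zero (res : MGFR k n M ℳ) (j : ℕ) (p : Fin (res.rk j))
    (hp : ∀ q, res.tw (j + 1) q ≤ res.tw j p) (x : Fin (res.rk (j + 1)) → MvPolynomial (Fin n) k) :
    res.diff j x p = 0 := by
  have h1 : ∀ q, res.diff j (Pi.single q 1) p = 0 := by
    intro q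
    have h2 := mem_sPiece.1 (res.graded_diff j _ _ (mem_fPiece.1 (single_mem (res.tw (j + 1)) q)) p)
    ext m
    by_contra hm
    have h3 := h2 m hm
    have h4 := hp q
    have h5 : m.degree = 0 := by omega
    rw [Finsupp.degree_eq_zero_iff] at h5
    subst h5
    exact hm (minimal_coeff res j _ p)
  have h2 : x = ∑ q, x q • (Pi.single q 1 : Fin (res.rk (j + 1)) → MvPolynomial (Fin n) k) := by
    funext l
    simp [Finset.sum_apply, Pi.single_apply]
  rw [h2, map_sum, Finset.sum_apply]
  refine Finset.sum_eq_zero fun q _ => ?_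
  rw [map_smul, Pi.smul_apply, h1, smul_zero]

lemma card_top_sub (T : {T : Finset (Fin n) // T.card = n + 1}) : False := by
  have := Finset.card_le_univ T.1
  rw [T.2, Fintype.card_fin] at this
  omega

lemma lower_succ_aux {A B C : Type*} [AddCommGroup A] [AddCommGroup B] [AddCommGroup C]
    [Module (MvPolynomial (Fin n) k) A] [Module (MvPolynomial (Fin n) k) B]
    [Module (MvPolynomial (Fin n) k) C] [Module k A] [Module k B] [Module k C]
    {𝒜 : ℤ → Submodule k A} {ℬ : ℤ → Submodule k B} {𝒞 : ℤ → Submodule k C}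
    {f : A →ₗ[MvPolynomial (Fin n) k] B} {g : B →ₗ[MvPolynomial (Fin n) k] C}
    (H : GSES 𝒜 ℬ 𝒞 f g) {d : ℤ} {t : ℕ} {a : Koch n A n}
    (hna : ∀ s : ℕ, ¬ ∃ w : Koch n A (n - 1), strand 𝒜 (t + s) (n - 1) d w ∧
        kdelta (k := k) (t + s) n w = (ktrans (k := k) n)^[s] a)
    {y : Koch n B (n - 1)} (hy : strand ℬ t (n - 1) d y)
    (hdy : kdelta (k := k) t n y = fun T => f (a T)) :
    0 < n ∧ lcNonvanish n 𝒞 (n - 1) d := by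
  have gen : ∀ (N : ℕ) (a : Koch n A N)
    (_ : ∀ s : ℕ, ¬ ∃ w : Koch n A (N - 1), strand 𝒜 (t + s) (N - 1) d w ∧
        kdelta (k := k) (t + s) N w = (ktrans (k := k) N)^[s] a)
    (y : Koch n B (N - 1)) (_ : strand ℬ t (N - 1) d y)
    (_ : kdelta (k := k) t N y = fun T => f (a T)),
    0 < N ∧ lcNonvanish n 𝒞 (N - 1) d := by
    intro N
    cases N with
    | zero =>
      intro a hna y hy hdy
      exfalso
      refine hna 0 ⟨0, fun T => Submodule.zero_mem _, ?_⟩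
      rw [kdelta_zero'] at hdy ⊢
      funext T
      apply H.inj
      simpa using congrFun hdy T
    | succ N =>
      intro a hna y hy hdy
      exact ⟨Nat.succ_pos _, H.down hna hy hdy⟩
  exact gen n a hna y hy hdy

lemma lower (hdec : DirectSum.IsInternal ℳ) (res : MGFR k n M ℳ) (j : ℕ) (p : Fin (res.rk j))
    (hp : ∀ q, res.tw (j + 1) q ≤ res.tw j p) :
    j ≤ n ∧ lcNonvanish n ℳ (n - j) (res.tw j p - n) := by
  have hx : ∀ x ∈ syzSub res j, x p = 0 := by
    intro x hx
    rw [syzSub_eq_range] at hx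
    obtain ⟨y, rfl⟩ := hx
    exact diff_coord_zero res j p hp y
  cases j with
  | zero =>
    refine ⟨Nat.zero_le _, 1, fun _ => res.aug (Pi.single p 1), ?_, ?_, ?_⟩
    · intro T
      have := res.graded_aug _ _ (mem_fPiece.1 (single_mem (res.tw 0) p))
      convert this using 2
      simp
    · funext T
      exact (card_top_sub T).elim
    · rintro s ⟨w, _, hw⟩
      exact top_nonvan res.aug res.aug_surj p hx s w hw
  | succ m =>
    have hsurj : Function.Surjective (dm res m) := by
      intro c
      obtain ⟨b, hb⟩ := (syzSub_eq_range res m).le c.2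
      exact ⟨b, Subtype.ext hb⟩
    have hna : ∀ s : ℕ, ¬ ∃ w : Koch n (syzSub res m) (n - 1),
        strand (syzPiece res m) (1 + s) (n - 1) (res.tw (m + 1) p - n) w ∧
        kdelta (k := k) (1 + s) n w =
          (ktrans (k := k) n)^[s] fun _ => dm res m (Pi.single p 1) := by
      rintro s ⟨w, _, hw⟩
      exact top_nonvan (dm res m) hsurj p (fun x h => hx x (congrArg Subtype.val h)) s w hw
    obtain ⟨y, hy, hdy⟩ := free_exact (res.tw m) n 1 (res.tw (m + 1) p - n)
      (fun _ => res.diff m (Pi.single p 1)) (by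
        intro T
        have := res.graded_diff m _ _ (mem_fPiece.1 (single_mem (res.tw (m + 1)) p))
        rw [mem_fPiece]
        intro l
        convert this l using 2
        simp) (by
        funext T
        exact (card_top_sub T).elim) (by
        intro T q e he _
        have : e = 0 := by
          ext l
          have := he l
          simp only [Finsupp.coe_zero, Pi.zero_apply]
          omega
        rw [this]
        exact minimal_coeff res m _ q)
    have key : 0 < n ∧ NVZ res (res.tw (m + 1) p - n) (n - 1) m := by
      cases m with
      | zero => exact lower_succ_aux (gses_zero hdec res) hna hy hdy
      | succ m => exact lower_succ_aux (gses_succ res m) hna hy hdy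
    obtain ⟨h1, h2⟩ := chain_down hdec res m (n - 1) (by omega) key.2
    refine ⟨by omega, ?_⟩
    rwa [show n - (m + 1) = n - 1 - m by omega]

lemma climb (res : MGFR k n M ℳ) : ∀ (c j : ℕ) (_ : res.len < j + c) (p : Fin (res.rk j)),
    ∃ j' p', j ≤ j' ∧ res.tw j p ≤ res.tw j' p' ∧ res.tw j p - j ≤ res.tw j' p' - j' ∧
      ∀ q, res.tw (j' + 1) q ≤ res.tw j' p' := by
  intro c
  induction c with
  | zero =>
    intro j hj p
    have := res.rk_top j (by omega)
    exact absurd p.2 (by omega)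
  | succ c ih =>
    intro j hj p
    by_cases h : ∀ q, res.tw (j + 1) q ≤ res.tw j p
    · exact ⟨j, p, le_rfl, le_rfl, le_rfl, h⟩
    · push Not at h
      obtain ⟨q, hq⟩ := h
      obtain ⟨j', p', h1, h2, h3, h4⟩ := ih (j + 1) (by omega) q
      refine ⟨j', p', by omega, by omega, ?_, h4⟩
      push_cast at h3
      omega

lemma aDeg_ge (hdec : DirectSum.IsInternal ℳ) (res : MGFR k n M ℳ) {i : ℕ} {d : ℤ}
    (h : lcNonvanish n ℳ i d) : (d : WithBot ℤ) ≤ aDeg n ℳ i := by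
  unfold aDeg
  rw [if_pos ⟨d, h⟩]
  refine WithBot.coe_le_coe.2 (le_csSup ?_ h)
  have hne : Nonempty (Fin (res.rk (n - i))) := ⟨(upper hdec res h).2.choose⟩
  refine ⟨(Finset.univ.sup' Finset.univ_nonempty fun p => res.tw (n - i) p), ?_⟩
  intro e he
  obtain ⟨p, hp⟩ := (upper hdec res he).2
  have := Finset.le_sup' (fun p => res.tw (n - i) p) (Finset.mem_univ p)
  have h0 : (0 : ℤ) ≤ n := Int.natCast_nonneg n
  linarith

lemma aDeg_cases (hdec : DirectSum.IsInternal ℳ) (res : MGFR k n M ℳ) (i : ℕ) :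
    aDeg n ℳ i = ⊥ ∨ ∃ d : ℤ, aDeg n ℳ i = d ∧ lcNonvanish n ℳ i d := by
  by_cases h : ∃ d : ℤ, lcNonvanish n ℳ i d
  · right
    refine ⟨sSup {d : ℤ | lcNonvanish n ℳ i d}, by unfold aDeg; rw [if_pos h], ?_⟩
    refine Int.csSup_mem (s := {d : ℤ | lcNonvanish n ℳ i d}) h ?_
    refine ⟨sSup {d : ℤ | lcNonvanish n ℳ i d}, fun e he => ?_⟩
    have := aDeg_ge hdec res he
    unfold aDeg at this
    rw [if_pos h] at this
    exact WithBot.coe_le_coe.1 this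
  · left
    unfold aDeg
    rw [if_neg h]

lemma bdeg_ge (res : MGFR k n M ℳ) (i : ℕ) (p : Fin (res.rk i)) :
    (res.tw i p : WithBot ℤ) ≤ bdeg res i :=
  Finset.le_sup (f := fun j : Fin (res.rk i) => ((res.tw i j : ℤ) : WithBot ℤ)) (Finset.mem_univ p)

lemma bdeg_cases (res : MGFR k n M ℳ) (i : ℕ) :
    bdeg res i = ⊥ ∨ ∃ p, bdeg res i = (res.tw i p : WithBot ℤ) := by
  by_cases h : (Finset.univ : Finset (Fin (res.rk i))).Nonempty
  · right
    obtain ⟨p, _, hp⟩ := Finset.exists_mem_eq_sup _ h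
      (fun j : Fin (res.rk i) => ((res.tw i j : ℤ) : WithBot ℤ))
    exact ⟨p, hp⟩
  · left
    rw [Finset.not_nonempty_iff_eq_empty] at h
    unfold bdeg
    rw [h, Finset.sup_empty]

lemma mem_Icc_len (res : MGFR k n M ℳ) {i t : ℕ} (p : Fin (res.rk (n - i))) (hi : i ≤ t) :
    n - i ∈ Finset.Icc (n - t) res.len := by
  rw [Finset.mem_Icc]
  refine ⟨by omega, ?_⟩
  by_contra h
  have := res.rk_top (n - i) (by omega)
  exact absurd p.2 (by omega)

lemma main_reg (hdec : DirectSum.IsInternal ℳ) (res : MGFR k n M ℳ) (t : ℕ) (ht : t ≤ n) :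
    regT n ℳ t =
      (Finset.Icc (n - t) res.len).sup
        (fun i => bdeg res i + ((-(i : ℤ) : ℤ) : WithBot ℤ)) := by
  apply le_antisymm
  · refine Finset.sup_le fun i hi => ?_
    have hi' : i ≤ t := by simpa [Nat.lt_succ_iff] using hi
    rcases aDeg_cases hdec res i with h | ⟨d, h, hd⟩
    · rw [h, WithBot.bot_add]; exact bot_le
    · obtain ⟨hin, p, hp⟩ := upper hdec res hd
      rw [h]
      refine le_trans ?_ (Finset.le_sup (f := fun i => bdeg res i + ((-(i : ℤ) : ℤ) : WithBot ℤ))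
        (mem_Icc_len res p hi'))
      refine le_trans ?_ (add_le_add_left (bdeg_ge res (n - i) p) _)
      rw [← WithBot.coe_add, ← WithBot.coe_add, WithBot.coe_le_coe]
      push_cast [hin]
      linarith
  · refine Finset.sup_le fun j hj => ?_
    rw [Finset.mem_Icc] at hj
    rcases bdeg_cases res j with h | ⟨p, h⟩
    · rw [h, WithBot.bot_add]; exact bot_le
    · rw [h]
      obtain ⟨j', p', h1, h2, h3, h4⟩ := climb res (res.len + 1) j (by omega) p
      obtain ⟨h5, h6⟩ := lower hdec res j' p' h4
      have h7 := aDeg_ge hdec res h6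
      refine le_trans ?_ (Finset.le_sup (f := fun i => aDeg n ℳ i + ((i : ℤ) : WithBot ℤ))
        (b := n - j') (Finset.mem_range.2 (by omega)))
      refine le_trans ?_ (add_le_add_left h7 _)
      rw [← WithBot.coe_add, ← WithBot.coe_add, WithBot.coe_le_coe]
      push_cast [h5]
      linarith

lemma main_star (hdec : DirectSum.IsInternal ℳ) (res : MGFR k n M ℳ) (t : ℕ) (ht : t ≤ n) :
    aStarT n ℳ t =
      (Finset.Icc (n - t) res.len).sup (fun i => bdeg res i) + ((-(n : ℤ) : ℤ) : WithBot ℤ) := by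
  apply le_antisymm
  · refine Finset.sup_le fun i hi => ?_
    have hi' : i ≤ t := by simpa [Nat.lt_succ_iff] using hi
    rcases aDeg_cases hdec res i with h | ⟨d, h, hd⟩
    · rw [h]; exact bot_le
    · obtain ⟨hin, p, hp⟩ := upper hdec res hd
      rw [h]
      refine le_trans ?_ (add_le_add_left (le_trans (bdeg_ge res (n - i) p)
        (Finset.le_sup (f := fun i => bdeg res i) (mem_Icc_len res p hi'))) _)
      rw [← WithBot.coe_add, WithBot.coe_le_coe]
      linarith
  · by_cases hne : (Finset.Icc (n - t) res.len).Nonempty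
    · obtain ⟨j, hj, hjs⟩ := Finset.exists_mem_eq_sup _ hne (fun i => bdeg res i)
      rw [hjs]
      rw [Finset.mem_Icc] at hj
      rcases bdeg_cases res j with h | ⟨p, h⟩
      · rw [h, WithBot.bot_add]; exact bot_le
      · rw [h]
        obtain ⟨j', p', h1, h2, h3, h4⟩ := climb res (res.len + 1) j (by omega) p
        obtain ⟨h5, h6⟩ := lower hdec res j' p' h4
        have h7 := aDeg_ge hdec res h6
        refine le_trans ?_ (Finset.le_sup (f := fun i => aDeg n ℳ i)
          (b := n - j') (Finset.mem_range.2 (by omega)))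
        refine le_trans ?_ h7
        rw [← WithBot.coe_add, WithBot.coe_le_coe]
        linarith
    · rw [Finset.not_nonempty_iff_eq_empty] at hne
      rw [hne, Finset.sup_empty, WithBot.bot_add]
      exact bot_le

end Resol

/-- Theorem 3.1: for a finitely generated graded module `M` with minimal graded free
resolution with maximal generator degrees `b_i`, for `0 ≤ t ≤ n`:
(i) `reg_t(M) = max{b_i - i : i ≥ n - t}`; (ii) `a*_t(M) = max{b_i : i ≥ n - t} - n`. -/
theorem statement10 {k : Type*} [Field k] {n : ℕ}
    {M : Type*} [AddCommGroup M] [Module k M]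
    [Module (MvPolynomial (Fin n) k) M] [IsScalarTower k (MvPolynomial (Fin n) k) M]
    [Module.Finite (MvPolynomial (Fin n) k) M]
    (ℳ : ℤ → Submodule k M) (hdec : DirectSum.IsInternal ℳ)
    (hcomp : ∀ (a : ℕ) (e : ℤ) (f : MvPolynomial (Fin n) k) (m : M),
      f ∈ homogeneousSubmodule (Fin n) k a → m ∈ ℳ e → f • m ∈ ℳ ((a : ℤ) + e))
    (res : MGFR k n M ℳ) (t : ℕ) (ht : t ≤ n) :
    regT n ℳ t =
      (Finset.Icc (n - t) res.len).sup (fun i => bdeg res i + ((-(i : ℤ) : ℤ) : WithBot ℤ)) ∧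
    aStarT n ℳ t =
      (Finset.Icc (n - t) res.len).sup (fun i => bdeg res i) + ((-(n : ℤ) : ℤ) : WithBot ℤ) := by
  exact ⟨main_reg hdec res t ht, main_star hdec res t ht⟩
end
end Paper
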